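/- Heat-type equation for the modified Weierstrass function: for every τ ∈ ℍ and every z ∈ ℂ with z ∉ Λ_τ, one has 2πi · ∂_τ P(z; τ) = ζ(z; τ) · P′(z; τ) − P(z; τ)² + (1/2) · P″(z; τ). -/

import Mathlib

open Complex

/-- The lattice `Λ_τ = ℤ + ℤτ ⊆ ℂ`. -/
def latticeSet (τ : ℂ) : Set ℂ := {z | ∃ m n : ℤ, z = (m : ℂ) + (n : ℂ) * τ}

/-- The Weierstrass `℘`-function `℘(z;τ) = 1/z² + ∑_{ω ∈ Λ_τ∖{0}} (1/(z−ω)² − 1/ω²)`,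
with the lattice parametrized by `(m,n) ∈ ℤ × ℤ`. -/
noncomputable def wp (τ z : ℂ) : ℂ :=
  1 / z ^ 2 + ∑' q : ℤ × ℤ, if q = 0 then 0 else
    (1 / (z - ((q.1 : ℂ) + (q.2 : ℂ) * τ)) ^ 2 - 1 / ((q.1 : ℂ) + (q.2 : ℂ) * τ) ^ 2)

/-- The Weierstrass zeta function
`ζ_W(z;τ) = 1/z + ∑_{ω ∈ Λ_τ∖{0}} (1/(z−ω) + 1/ω + z/ω²)`. -/
noncomputable def wzeta (τ z : ℂ) : ℂ :=
  1 / z + ∑' q : ℤ × ℤ, if q = 0 then 0 else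
    (1 / (z - ((q.1 : ℂ) + (q.2 : ℂ) * τ)) + 1 / ((q.1 : ℂ) + (q.2 : ℂ) * τ)
      + z / ((q.1 : ℂ) + (q.2 : ℂ) * τ) ^ 2)

/-- The weight-two Eisenstein series `E₂(τ) = 1 − 24 ∑_{n≥1} σ₁(n) e^{2πinτ}`. -/
noncomputable def eisensteinE2 (τ : ℂ) : ℂ :=
  1 - 24 * ∑' n : ℕ,
    ((ArithmeticFunction.sigma 1 (n + 1) : ℕ) : ℂ) *
      Complex.exp (2 * Real.pi * Complex.I * ((n : ℂ) + 1) * τ)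

/-- The modified Weierstrass function (propagator) `P(z;τ) = ℘(z;τ) + (π²/3)E₂(τ)`. -/
noncomputable def Pfun (τ z : ℂ) : ℂ := wp τ z + ((Real.pi : ℂ) ^ 2 / 3) * eisensteinE2 τ

/-- The modified Weierstrass zeta function `ζ(z;τ) = ζ_W(z;τ) − (π²/3)E₂(τ)·z`. -/
noncomputable def zetafun (τ z : ℂ) : ℂ := wzeta τ z - ((Real.pi : ℂ) ^ 2 / 3) * eisensteinE2 τ * z

open Filter Topology

/-- The function `π cot (π w)`. -/
noncomputable def piCot (w : ℂ) : ℂ := Real.pi * cot (Real.pi * w)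

/-- The function `π² / sin² (π w)`. -/
noncomputable def piCscSq (w : ℂ) : ℂ := (Real.pi / sin (Real.pi * w)) ^ 2

lemma sin_pi_mul_ne_zero_of_forall {w : ℂ} (hw : ∀ m : ℤ, w + m ≠ 0) :
    sin (Real.pi * w) ≠ 0 := by
  refine sin_pi_mul_ne_zero (fun ⟨m, hm⟩ => hw (-m) ?_)
  simp [← hm]

lemma piCot_zero : piCot 0 = 0 := by simp [piCot, cot]

lemma piCot_neg (w : ℂ) : piCot (-w) = -piCot w := by
  simp [piCot, cot, div_neg]

lemma piCscSq_eq {w : ℂ} (hw : sin (Real.pi * w) ≠ 0) :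
    piCscSq w = Real.pi ^ 2 + piCot w ^ 2 := by
  have := sin_sq_add_cos_sq (Real.pi * w)
  simp only [piCscSq, piCot, cot]
  field_simp
  linear_combination -(1 : ℂ) * this

lemma hasDerivAt_piCot {w : ℂ} (hw : sin (Real.pi * w) ≠ 0) :
    HasDerivAt piCot (-piCscSq w) w := by
  have hm : HasDerivAt (fun w : ℂ => Real.pi * w) (Real.pi : ℂ) w := by
    simpa using (hasDerivAt_id w).const_mul (Real.pi : ℂ)
  have h := ((hm.ccos.div hm.csin hw)).const_mul (Real.pi : ℂ)
  refine (h.congr_deriv ?_)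
  have := sin_sq_add_cos_sq (Real.pi * w)
  simp only [piCscSq]
  field_simp
  linear_combination -(Real.pi : ℂ) ^ 0 * this

lemma hasDerivAt_piCscSq {w : ℂ} (hw : sin (Real.pi * w) ≠ 0) :
    HasDerivAt piCscSq (-2 * piCot w * piCscSq w) w := by
  have hm : HasDerivAt (fun w : ℂ => Real.pi * w) (Real.pi : ℂ) w := by
    simpa using (hasDerivAt_id w).const_mul (Real.pi : ℂ)
  have h := (((hasDerivAt_const w (Real.pi : ℂ)).div hm.csin hw)).pow 2
  refine (h.congr_deriv ?_)
  simp only [piCscSq, piCot, cot, Pi.div_apply]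
  generalize sin (Real.pi * w) = x at *
  push_cast
  field_simp
  ring

lemma piCot_sub_mul {a b : ℂ} (ha : sin (Real.pi * a) ≠ 0) (hb : sin (Real.pi * b) ≠ 0)
    (hab : sin (Real.pi * (b - a)) ≠ 0) :
    piCot (b - a) * (piCot a - piCot b) = piCot a * piCot b + Real.pi ^ 2 := by
  have h1 : sin (Real.pi * (b - a)) = sin (Real.pi * b) * cos (Real.pi * a)
      - cos (Real.pi * b) * sin (Real.pi * a) := by rw [mul_sub, sin_sub]
  have h2 : cos (Real.pi * (b - a)) = cos (Real.pi * b) * cos (Real.pi * a)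
      + sin (Real.pi * b) * sin (Real.pi * a) := by rw [mul_sub, cos_sub]
  simp only [piCot, cot]
  rw [h2, h1]
  rw [h1] at hab
  generalize sin (Real.pi * a) = x at *
  generalize sin (Real.pi * b) = y at *
  generalize cos (Real.pi * a) = u at *
  generalize cos (Real.pi * b) = v at *
  rw [mul_div_assoc', div_mul_eq_mul_div, div_eq_iff hab]
  field_simp

lemma abs_im_le_norm_sin (w : ℂ) : |w.im| ≤ ‖sin w‖ := by
  have h1 : ‖sin w‖ = ‖exp (-w * I) - exp (w * I)‖ / 2 := by simp [sin]
  have h2 : ‖exp (-w * I)‖ = Real.exp w.im := by simp [norm_exp]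
  have h3 : ‖exp (w * I)‖ = Real.exp (-w.im) := by simp [norm_exp]
  have h4 := abs_norm_sub_norm_le (exp (-w * I)) (exp (w * I))
  rw [h2, h3] at h4
  have h5 : |w.im| ≤ |Real.sinh w.im| := by
    rw [Real.abs_sinh]
    exact Real.self_le_sinh_iff.mpr (abs_nonneg _)
  rw [Real.sinh_eq, abs_div, abs_two] at h5
  rw [h1]
  linarith

lemma norm_piCscSq_le {w : ℂ} (hw : w.im ≠ 0) : ‖piCscSq w‖ ≤ 1 / w.im ^ 2 := by
  have key : (Real.pi * |w.im|) ^ 2 ≤ ‖sin (Real.pi * w)‖ ^ 2 := by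
    gcongr
    simpa [abs_mul, abs_of_pos Real.pi_pos] using abs_im_le_norm_sin (Real.pi * w)
  have hpos : 0 < ‖sin (Real.pi * w)‖ ^ 2 := lt_of_lt_of_le (by positivity) key
  rw [piCscSq, norm_pow, norm_div, div_pow, div_le_div_iff₀ hpos (by positivity)]
  simpa [abs_of_pos Real.pi_pos, mul_pow] using key

lemma hasSum_piCot {w : ℂ} (hw : ∀ m : ℤ, w + m ≠ 0) :
    HasSum (fun m : ℤ => 1 / (w + m) - 1 / (m : ℂ)) (piCot w) := by
  have hw' : w ∈ integerComplement := fun ⟨m, hm⟩ => hw (-m) (by simp [← hm])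
  have hS : Summable (fun m : ℤ => 1 / (w + m) - 1 / (m : ℂ)) := by
    have h := (EisensteinSeries.summable_linear_sub_mul_linear_add w 0 1).mul_left w
    rw [← Finset.summable_compl_iff (s := {0})] at *
    refine h.congr fun m => ?_
    have hm : (m.1 : ℂ) ≠ 0 := by simpa using m.2
    have := hw m
    simp only [Int.cast_zero, zero_mul, zero_sub, Int.cast_one, one_mul]
    field_simp
    ring
  convert hS.hasSum using 1
  have hpos : Summable (fun n : ℕ+ => 1 / (w + ((n : ℤ) : ℂ)) - 1 / ((n : ℤ) : ℂ)) :=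
    hS.comp_injective (i := fun n : ℕ+ => (n : ℤ)) (fun a b h => by simpa using h)
  have hneg : Summable (fun n : ℕ+ => 1 / (w + ((-(n : ℤ) : ℤ) : ℂ)) - 1 / ((-(n : ℤ) : ℤ) : ℂ)) :=
    hS.comp_injective (i := fun n : ℕ+ => -(n : ℤ)) (fun a b h => by simpa using h)
  rw [piCot, cot_series_rep hw', tsum_int_eq_zero_add_tsum_pnat hS, add_assoc,
    ← hpos.tsum_add hneg]
  congr 1
  · simp
  · refine tsum_congr fun n => ?_
    push_cast
    rw [div_neg, ← sub_eq_add_neg]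
    ring

/-- A family of functions which is locally bounded at a point termwise, and bounded by a summable
sequence near that point for all but finitely many terms, is dominated near the point. -/
lemma exists_summable_bound {ι X : Type*} [TopologicalSpace X] {F : ι → X → ℂ} {x : X}
    {g : ι → ℝ} (hg : Summable g) (hF : ∀ i, ContinuousAt (F i) x)
    (hb : ∃ s : Set ι, s.Finite ∧ ∀ᶠ y in 𝓝 x, ∀ i ∉ s, ‖F i y‖ ≤ g i) :
    ∃ u : ι → ℝ, Summable u ∧ ∀ᶠ y in 𝓝 x, ∀ i, ‖F i y‖ ≤ u i := by
  classical
  obtain ⟨s, hs, hb⟩ := hb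
  refine ⟨fun i => if i ∈ s then ‖F i x‖ + 1 else g i, ?_, ?_⟩
  · refine hg.congr_cofinite ?_
    filter_upwards [hs.compl_mem_cofinite] with i hi
    simp [show i ∉ s from hi]
  · have h1 : ∀ᶠ y in 𝓝 x, ∀ i ∈ s, ‖F i y‖ ≤ ‖F i x‖ + 1 := by
      rw [eventually_all_finite hs]
      exact fun i _ => ((hF i).norm.eventually_lt_const (lt_add_one _)).mono fun _ h => h.le
    filter_upwards [hb, h1] with y h2 h1 i
    by_cases hi : i ∈ s
    · simpa [hi] using h1 i hi
    · simpa [hi] using h2 i hi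

lemma finite_setOf_abs_intCast_lt (B : ℝ) : {n : ℤ | |(n : ℝ)| < B}.Finite := by
  refine (Set.finite_Icc (-⌈B⌉) ⌈B⌉).subset fun n (hn : |(n : ℝ)| < B) => ?_
  have h := abs_lt.mp (hn.trans_le (Int.le_ceil B))
  constructor <;> [have := h.1; have := h.2] <;> exact_mod_cast this.le

lemma eventually_sin_pi_mul_ne_zero {w : ℂ} (hw : sin (Real.pi * w) ≠ 0) :
    ∀ᶠ v in 𝓝 w, sin (Real.pi * v) ≠ 0 :=
  ContinuousAt.eventually_ne (g := fun v : ℂ => sin (Real.pi * v)) (by fun_prop) hw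

lemma add_intCast_ne_zero_of_sin {w : ℂ} (hw : sin (Real.pi * w) ≠ 0) (m : ℤ) : w + m ≠ 0 := by
  intro h
  rw [eq_neg_of_add_eq_zero_left h] at hw
  exact hw (by rw [mul_comm, ← Int.cast_neg]; exact sin_int_mul_pi _)

lemma hasSum_piCscSq {w : ℂ} (hw : ∀ m : ℤ, w + m ≠ 0) :
    HasSum (fun m : ℤ => 1 / (w + m) ^ 2) (piCscSq w) := by
  have hopen : ∀ᶠ v : ℂ in 𝓝 w, ∀ m : ℤ, v + m ≠ 0 :=
    (eventually_sin_pi_mul_ne_zero (sin_pi_mul_ne_zero_of_forall hw)).mono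
      fun v hv => add_intCast_ne_zero_of_sin hv
  have hbound : ∃ s : Set ℤ, s.Finite ∧ ∀ᶠ v : ℂ in 𝓝 w, ∀ m ∉ s,
      ‖1 / (v + m) - 1 / (m : ℂ)‖ ≤ 2 * (‖w‖ + 1) * (1 / (m : ℝ) ^ 2) := by
    refine ⟨_, finite_setOf_abs_intCast_lt (2 * (‖w‖ + 1)), ?_⟩
    filter_upwards [continuous_norm.continuousAt.eventually_lt_const (lt_add_one ‖w‖), hopen]
      with v hv hv' m hm
    replace hm := not_lt.mp hm
    have hw0 := norm_nonneg w
    have hmpos : 0 < |(m : ℝ)| := by linarith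
    have hm0 : (m : ℂ) ≠ 0 := by
      intro h
      rw [Int.cast_eq_zero] at h
      simp [h] at hmpos
    have h1 : |(m : ℝ)| / 2 ≤ ‖v + m‖ := by
      have := norm_sub_le (v + m) v
      rw [add_sub_cancel_left, norm_intCast] at this
      linarith
    rw [div_sub_div _ _ (hv' m) hm0, norm_div, norm_mul, norm_intCast, ← sq_abs]
    have h2 : ‖1 * (m : ℂ) - (v + m) * 1‖ = ‖v‖ := by
      rw [← norm_neg]; congr 1; ring
    rw [h2, mul_one_div, div_le_div_iff₀ (mul_pos (by linarith) hmpos) (by positivity)]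
    have h3 : (‖w‖ + 1) * |(m : ℝ)| * (|(m : ℝ)| / 2) ≤ (‖w‖ + 1) * |(m : ℝ)| * ‖v + m‖ := by
      gcongr
    have h4 : ‖v‖ * |(m : ℝ)| ^ 2 ≤ (‖w‖ + 1) * |(m : ℝ)| ^ 2 := by
      gcongr
    linarith
  obtain ⟨u, hu, hbd⟩ := exists_summable_bound
    ((Real.summable_one_div_int_pow.mpr one_lt_two).mul_left (2 * (‖w‖ + 1)))
    (fun m : ℤ => by
      have := hw m
      fun_prop (disch := assumption)) hbound
  obtain ⟨U, hU, hUo, hwU⟩ := eventually_nhds_iff.mp (hopen.and hbd)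
  have hd (m : ℤ) {v : ℂ} (hv : v ∈ U) :
      HasDerivAt (fun v : ℂ => 1 / (v + m) - 1 / (m : ℂ)) (-(1 / (v + m) ^ 2)) v := by
    have h := (((hasDerivAt_id v).add_const (m : ℂ)).inv ((hU v hv).1 m)).sub_const (1 / (m : ℂ))
    simpa [neg_div] using h
  have h := hasSum_deriv_of_summable_norm hu
    (fun m v hv => (hd m hv).differentiableAt.differentiableWithinAt) hUo
    (fun m v hv => (hU v hv).2 m) hwU
  have he : (fun v => ∑' m : ℤ, (1 / (v + m) - 1 / (m : ℂ))) =ᶠ[𝓝 w] piCot :=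
    hopen.mono fun v hv => (hasSum_piCot hv).tsum_eq
  rw [he.deriv_eq, (hasDerivAt_piCot (sin_pi_mul_ne_zero_of_forall hw)).deriv] at h
  have e : (fun m : ℤ => 1 / (w + m) ^ 2) =
      fun m : ℤ => -deriv (fun v : ℂ => 1 / (v + m) - 1 / (m : ℂ)) w :=
    funext fun m => by rw [(hd m hwU).deriv, neg_neg]
  rw [e]
  simpa only [neg_neg] using h.neg

/-- A finite form of the quasi-periodic product identity: the terms are paired antisymmetrically. -/
lemma sum_mul_sum_sub_sq_add_half_sum (s : Finset ℤ) (c k : ℤ → ℂ)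
    (hk0 : k 0 = 0) (hk : ∀ j, k (-j) = -k j)
    (hck : ∀ m n, m ≠ n → k (m - n) * (c n - c m) = c n * c m + (Real.pi : ℂ) ^ 2) :
    (∑ n ∈ s, c n) * (∑ n ∈ s, -2 * c n * (Real.pi ^ 2 + c n ^ 2))
      - (∑ n ∈ s, (Real.pi ^ 2 + c n ^ 2)) ^ 2
      + 1 / 2 * ∑ n ∈ s, (2 * (Real.pi ^ 2 + c n ^ 2) ^ 2
          + 4 * c n ^ 2 * (Real.pi ^ 2 + c n ^ 2)) =
    ∑ n ∈ s, -2 * c n * (Real.pi ^ 2 + c n ^ 2) * ∑ m ∈ s, k (m - n) := by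
  set T : ℤ → ℤ → ℂ := fun n m => c m * (-2 * c n * (Real.pi ^ 2 + c n ^ 2))
    - (Real.pi ^ 2 + c n ^ 2) * (Real.pi ^ 2 + c m ^ 2)
    + (if n = m then 1 / 2 * (2 * (Real.pi ^ 2 + c n ^ 2) ^ 2
          + 4 * c n ^ 2 * (Real.pi ^ 2 + c n ^ 2)) else 0)
    - -2 * c n * (Real.pi ^ 2 + c n ^ 2) * k (m - n) with hT
  have hanti (n m : ℤ) : T n m = -T m n := by
    by_cases h : n = m
    · subst h
      simp only [hT, sub_self, hk0, if_true]
      ring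
    · have h1 := hck m n (Ne.symm h)
      have h2 : k (n - m) = -k (m - n) := by rw [← hk, neg_sub]
      simp only [hT, h, Ne.symm h, if_false, h2]
      linear_combination 2 * (c m ^ 2 + c m * c n + c n ^ 2 + Real.pi ^ 2) * h1
  have hzero : ∑ n ∈ s, ∑ m ∈ s, T n m = 0 := by
    have h : ∑ n ∈ s, ∑ m ∈ s, T n m = -∑ n ∈ s, ∑ m ∈ s, T n m := by
      conv_rhs => rw [Finset.sum_comm]
      simp only [← Finset.sum_neg_distrib]
      exact Finset.sum_congr rfl fun n _ => Finset.sum_congr rfl fun m _ => hanti n m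
    linear_combination 1 / 2 * h
  simp only [hT, Finset.sum_sub_distrib, Finset.sum_add_distrib, Finset.sum_ite_eq,
    Finset.sum_ite_mem, Finset.inter_self, ← Finset.mul_sum, ← Finset.sum_mul] at hzero
  simp only [Finset.sum_add_distrib, ← Finset.mul_sum]
  linear_combination hzero

/-- The effect of a unit shift on the symmetric partial sums of a function on `ℤ`. -/
lemma sum_Icc_sub_succ (k : ℤ → ℂ) (N : ℕ) (n : ℤ) :
    ∑ m ∈ Finset.Icc (-(N : ℤ)) N, k (m - (n + 1)) =
      ∑ m ∈ Finset.Icc (-(N : ℤ)) N, k (m - n) + k (-N - n - 1) - k (N - n) := by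
  induction N with
  | zero => simp; ring_nf
  | succ N ih =>
    have h (f : ℤ → ℂ) : ∑ m ∈ Finset.Icc (-((N + 1 : ℕ) : ℤ)) (N + 1 : ℕ), f m =
        ∑ m ∈ Finset.Icc (-(N : ℤ)) N, f m + f (N + 1) + f (-N - 1) := by
      have := Finset.sum_Icc_succ_eq_add_endpoints f (N := N)
      push_cast at this ⊢
      rw [this]; ring_nf
    rw [h, h, ih, show (N : ℤ) + 1 - (n + 1) = N - n by ring,
      show -(N : ℤ) - 1 - (n + 1) = -(N + 1 : ℕ) - n - 1 by push_cast; ring,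
      show -(N : ℤ) - 1 - n = -N - n - 1 by ring, show ((N + 1 : ℕ) : ℤ) - n = N + 1 - n by simp]
    ring

lemma sum_Icc_neg_eq_zero {k : ℤ → ℂ} (hk : ∀ j, k (-j) = -k j) (N : ℕ) :
    ∑ m ∈ Finset.Icc (-(N : ℤ)) N, k m = 0 := by
  have h : ∑ m ∈ Finset.Icc (-(N : ℤ)) N, k m = ∑ m ∈ Finset.Icc (-(N : ℤ)) N, k (-m) := by
    refine Finset.sum_nbij' (fun m => -m) (fun m => -m) ?_ ?_ ?_ ?_ ?_ <;> simp <;> intros <;> omega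
  simp only [hk, Finset.sum_neg_distrib] at h
  linear_combination 1 / 2 * h

lemma norm_sum_Icc_sub_le {k : ℤ → ℂ} (hk : ∀ j, k (-j) = -k j) {C : ℝ} (hC : ∀ j, ‖k j‖ ≤ C)
    (N : ℕ) (n : ℤ) :
    ‖∑ m ∈ Finset.Icc (-(N : ℤ)) N, k (m - n)‖ ≤ 2 * C * |(n : ℝ)| := by
  have hstep (n : ℤ) : ‖∑ m ∈ Finset.Icc (-(N : ℤ)) N, k (m - (n + 1))
      - ∑ m ∈ Finset.Icc (-(N : ℤ)) N, k (m - n)‖ ≤ 2 * C := by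
    rw [sum_Icc_sub_succ, add_sub_assoc, add_sub_cancel_left]
    linarith [norm_sub_le (k (-N - n - 1)) (k (N - n)), hC (-N - n - 1), hC (N - n)]
  induction n with
  | zero => simp [sum_Icc_neg_eq_zero hk]
  | succ n ih =>
    have h1 := norm_le_norm_add_norm_sub' (∑ m ∈ Finset.Icc (-(N : ℤ)) N, k (m - (n + 1)))
      (∑ m ∈ Finset.Icc (-(N : ℤ)) N, k (m - n))
    have h2 := hstep n
    push_cast at ih ⊢
    rw [abs_of_nonneg (by positivity)] at ih ⊢
    linarith
  | pred n ih =>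
    have h1 := norm_le_norm_add_norm_sub (∑ m ∈ Finset.Icc (-(N : ℤ)) N, k (m - -n))
      (∑ m ∈ Finset.Icc (-(N : ℤ)) N, k (m - (-n - 1)))
    have h2 := hstep (-n - 1)
    rw [sub_add_cancel] at h2
    push_cast at ih ⊢
    rw [abs_of_nonpos (by simp)] at ih
    rw [abs_of_nonpos (by linarith [n.cast_nonneg (α := ℝ)])]
    linarith

lemma tendsto_sum_Icc_sub {k : ℤ → ℂ} (hk : ∀ j, k (-j) = -k j) {a : ℂ}
    (ha : Tendsto k atTop (𝓝 a)) (n : ℤ) :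
    Tendsto (fun N : ℕ => ∑ m ∈ Finset.Icc (-(N : ℤ)) N, k (m - n)) atTop (𝓝 (-2 * a * n)) := by
  have ha' (n : ℤ) : Tendsto (fun N : ℕ => k (N - n)) atTop (𝓝 a) :=
    ha.comp (tendsto_atTop_add_const_right _ (-n) tendsto_natCast_atTop_atTop)
  have hstep (n : ℤ) : Tendsto (fun N : ℕ => k (-N - n - 1) - k (N - n)) atTop (𝓝 (-a - a)) := by
    refine Tendsto.sub ?_ (ha' n)
    refine (ha' (-n - 1)).neg.congr fun N => ?_
    rw [← hk]
    congr 1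
    ring
  induction n with
  | zero => simp [sum_Icc_neg_eq_zero hk]
  | succ n ih =>
    have := ih.add (hstep n)
    convert! this using 2
    · rw [sum_Icc_sub_succ]; ring
    · push_cast; ring
  | pred n ih =>
    have := ih.sub (hstep (-n - 1))
    convert! this using 2 with N
    · have := sum_Icc_sub_succ k N (-n - 1)
      rw [sub_add_cancel] at this
      rw [this]; ring
    · push_cast; ring

lemma tendsto_piCot_mul_atTop {τ : ℂ} (hτ : 0 < τ.im) :
    Tendsto (fun k : ℤ => piCot (k * τ)) atTop (𝓝 (-(Real.pi * I))) := by
  have hq : Tendsto (fun k : ℤ => exp (2 * Real.pi * I * (k * τ))) atTop (𝓝 0) := by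
    rw [tendsto_exp_nhds_zero_iff]
    have h1 : Tendsto (fun k : ℤ => (k : ℝ) * (-(2 * Real.pi * τ.im))) atTop atBot :=
      tendsto_intCast_atTop_atTop.atTop_mul_const_of_neg
        (by nlinarith [Real.pi_pos, mul_pos Real.pi_pos hτ])
    refine h1.congr fun k => ?_
    simp
    ring
  have h := ((hq.add_const 1).div ((hq.const_sub 1).const_mul I) (by simp)).const_mul (Real.pi : ℂ)
  simp only [piCot, cot_pi_eq_exp_ratio]
  convert! h using 2
  simp

lemma exists_norm_piCot_intCast_mul_le {τ : ℂ} (hτ : 0 < τ.im) :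
    ∃ C : ℝ, ∀ k : ℤ, ‖piCot (k * τ)‖ ≤ C := by
  have h : Tendsto (fun k : ℕ => piCot (k * τ)) atTop (𝓝 (-(Real.pi * I))) :=
    (tendsto_piCot_mul_atTop hτ).comp tendsto_natCast_atTop_atTop |>.congr fun k => by simp
  obtain ⟨C, hC⟩ := h.norm.bddAbove_range
  rw [mem_upperBounds, Set.forall_mem_range] at hC
  refine ⟨C, fun k => ?_⟩
  obtain ⟨n, rfl | rfl⟩ := k.eq_nat_or_neg
  · simpa using hC n
  · simpa [piCot_neg] using hC n

/-- The summands of `∑ n, π² / sin² (π (z + n τ))` are dominated, locally uniformly in `(z, τ)`. -/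
lemma exists_summable_bound_piCscSq {τ z : ℂ} (hτ : 0 < τ.im)
    (hz : ∀ n : ℤ, sin (Real.pi * (z + n * τ)) ≠ 0) :
    ∃ u : ℤ → ℝ, Summable u ∧ ∀ᶠ p : ℂ × ℂ in 𝓝 (z, τ), ∀ n : ℤ,
      sin (Real.pi * (p.1 + n * p.2)) ≠ 0 ∧ ‖piCscSq (p.1 + n * p.2)‖ ≤ u n := by
  set B := 4 * (|z.im| + 1) / τ.im with hB
  have hfin := finite_setOf_abs_intCast_lt B
  have hzim : ∀ᶠ p : ℂ × ℂ in 𝓝 (z, τ), |p.1.im| < |z.im| + 1 :=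
    (show ContinuousAt (fun p : ℂ × ℂ => |p.1.im|) (z, τ) by fun_prop).eventually_lt_const
      (lt_add_one _)
  have hτim : ∀ᶠ p : ℂ × ℂ in 𝓝 (z, τ), τ.im / 2 < p.2.im :=
    (show ContinuousAt (fun p : ℂ × ℂ => p.2.im) (z, τ) by fun_prop).eventually_const_lt
      (half_lt_self hτ)
  have him : ∀ᶠ p : ℂ × ℂ in 𝓝 (z, τ), ∀ n ∉ {n : ℤ | |(n : ℝ)| < B},
      |(n : ℝ)| * (τ.im / 4) ≤ |(p.1 + n * p.2).im| ∧ 0 < |(n : ℝ)| := by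
    filter_upwards [hzim, hτim] with p h1 h2 n hn
    replace hn := not_lt.mp hn
    rw [hB, div_le_iff₀ hτ] at hn
    have h3 : |(n : ℝ)| * (τ.im / 2) ≤ |(n : ℝ) * p.2.im| := by
      rw [abs_mul, abs_of_pos (a := p.2.im) (by linarith)]
      gcongr
    have h4 : |(n : ℝ) * p.2.im| - |p.1.im| ≤ |(p.1 + n * p.2).im| := by
      have := abs_sub_abs_le_abs_sub ((n : ℝ) * p.2.im) (-p.1.im)
      simp only [abs_neg, sub_neg_eq_add] at this
      simpa [add_comm] using this
    refine ⟨by linarith, ?_⟩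
    by_contra! h
    nlinarith [abs_nonneg z.im]
  have hb : ∃ s : Set ℤ, s.Finite ∧ ∀ᶠ p : ℂ × ℂ in 𝓝 (z, τ), ∀ n ∉ s,
      ‖piCscSq (p.1 + n * p.2)‖ ≤ (4 / τ.im) ^ 2 * (1 / (n : ℝ) ^ 2) := by
    refine ⟨_, hfin, him.mono fun p hp n hn => ?_⟩
    obtain ⟨h1, h2⟩ := hp n hn
    have h3 : 0 < |(n : ℝ)| * (τ.im / 4) := by positivity
    refine (norm_piCscSq_le (abs_pos.mp (h3.trans_le h1))).trans ?_
    rw [← sq_abs (p.1 + n * p.2).im, ← sq_abs (n : ℝ)]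
    calc 1 / |(p.1 + n * p.2).im| ^ 2 ≤ 1 / (|(n : ℝ)| * (τ.im / 4)) ^ 2 := by gcongr
      _ = _ := by field_simp
  obtain ⟨u, hu, hbd⟩ := exists_summable_bound
    (F := fun (n : ℤ) (p : ℂ × ℂ) => piCscSq (p.1 + n * p.2))
    ((Real.summable_one_div_int_pow.mpr one_lt_two).mul_left ((4 / τ.im) ^ 2))
    (fun n => ContinuousAt.comp (x := (z, τ)) (g := piCscSq) (f := fun p : ℂ × ℂ => p.1 + n * p.2)
      (hasDerivAt_piCscSq (hz n)).continuousAt (by fun_prop)) hb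
  refine ⟨u, hu, ?_⟩
  have hsin1 : ∀ᶠ p : ℂ × ℂ in 𝓝 (z, τ), ∀ n ∈ {n : ℤ | |(n : ℝ)| < B},
      sin (Real.pi * (p.1 + n * p.2)) ≠ 0 := by
    rw [eventually_all_finite hfin]
    exact fun n _ => ContinuousAt.eventually_ne
      (g := fun p : ℂ × ℂ => sin (Real.pi * (p.1 + n * p.2))) (by fun_prop) (hz n)
  filter_upwards [hbd, hsin1, him] with p h1 h2 h3 n
  refine ⟨?_, h1 n⟩
  by_cases hn : n ∈ {n : ℤ | |(n : ℝ)| < B}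
  · exact h2 n hn
  · obtain ⟨h4, h5⟩ := h3 n hn
    have h6 : 0 < |(p.1 + n * p.2).im| := (by positivity : 0 < |(n : ℝ)| * (τ.im / 4)).trans_le h4
    refine sin_pi_mul_ne_zero_of_forall fun m hm => abs_pos.mp h6 ?_
    simpa using congrArg im hm

open EisensteinSeries
open scoped UpperHalfPlane

lemma intCast_mul_add_ne_zero (τ : ℍ) {n : ℤ} (hn : n ≠ 0) (m : ℤ) : (n : ℂ) * τ + m ≠ 0 := by
  intro h
  exact hn (by simpa [τ.im_pos.ne'] using congrArg im h)

lemma summable_one_div_norm_lattice_pow_three (τ : ℍ) :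
    Summable fun q : ℤ × ℤ => 1 / ‖(q.1 : ℂ) * τ + q.2‖ ^ 3 := by
  refine (summable_prod_eisSummand le_rfl τ).norm.congr fun q => ?_
  rw [eisSummand, zpow_neg, norm_inv, zpow_natCast, norm_pow, one_div]
  rfl

lemma eventually_norm_lattice_gt (τ : ℍ) (B : ℝ) :
    ∀ᶠ q : ℤ × ℤ in cofinite, B < ‖(q.1 : ℂ) * τ + q.2‖ := by
  have h := (summable_one_div_norm_lattice_pow_three τ).tendsto_cofinite_zero
  have hB : (0 : ℝ) < 1 / max B 1 ^ 3 := by positivity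
  have h0 : ∀ᶠ q : ℤ × ℤ in cofinite, q ≠ 0 := (Set.finite_singleton 0).compl_mem_cofinite
  filter_upwards [h.eventually_lt_const hB, h0] with q hq hq0
  have hne : (q.1 : ℂ) * τ + q.2 ≠ 0 := by
    by_cases h1 : q.1 = 0
    · have h2 : q.2 ≠ 0 := fun h2 => hq0 (Prod.ext h1 h2)
      simpa [h1] using h2
    · exact intCast_mul_add_ne_zero τ h1 _
  have hpos : 0 < ‖(q.1 : ℂ) * τ + q.2‖ := norm_pos_iff.mpr hne
  rw [one_div_lt_one_div (by positivity) (by positivity)] at hq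
  exact (le_max_left _ _).trans_lt (lt_of_pow_lt_pow_left₀ 3 hpos.le hq)

lemma half_norm_le_norm_add {z w : ℂ} (h : 2 * ‖z‖ < ‖w‖) : ‖w‖ / 2 ≤ ‖z + w‖ := by
  have := norm_sub_le (z + w) z
  rw [add_sub_cancel_left] at this
  linarith

lemma summable_wp (τ : ℍ) (z : ℂ) : Summable fun q : ℤ × ℤ =>
    1 / (z + (q.1 * τ + q.2)) ^ 2 - 1 / ((q.1 : ℂ) * τ + q.2) ^ 2 := by
  refine .of_norm_bounded_eventually
    ((summable_one_div_norm_lattice_pow_three τ).mul_left (10 * ‖z‖)) ?_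
  filter_upwards [eventually_norm_lattice_gt τ (2 * ‖z‖)] with q hq
  generalize (q.1 : ℂ) * τ + q.2 = w at hq
  have h1 := half_norm_le_norm_add hq
  have hz := norm_nonneg z
  have hw : 0 < ‖w‖ := by linarith
  have hw0 := norm_pos_iff.mp hw
  have hzw : 0 < ‖z + w‖ := by linarith
  have hzw0 := norm_pos_iff.mp hzw
  have e : 1 / (z + w) ^ 2 - 1 / w ^ 2 = -(z * (2 * w + z)) / (w ^ 2 * (z + w) ^ 2) := by
    field_simp
    ring
  have h2 : ‖2 * w + z‖ ≤ 5 / 2 * ‖w‖ := by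
    have := norm_add_le (2 * w) z
    simp only [norm_mul, norm_ofNat] at this
    linarith
  rw [e, norm_div, norm_neg, norm_mul, norm_mul, norm_pow, norm_pow]
  calc ‖z‖ * ‖2 * w + z‖ / (‖w‖ ^ 2 * ‖z + w‖ ^ 2)
      ≤ ‖z‖ * (5 / 2 * ‖w‖) / (‖w‖ ^ 2 * (‖w‖ / 2) ^ 2) := by gcongr
    _ = 10 * ‖z‖ * (1 / ‖w‖ ^ 3) := by field_simp; ring

lemma summable_wzeta (τ : ℍ) (z : ℂ) : Summable fun q : ℤ × ℤ =>
    1 / (z + (q.1 * τ + q.2)) - 1 / ((q.1 : ℂ) * τ + q.2) + z / ((q.1 : ℂ) * τ + q.2) ^ 2 := by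
  refine .of_norm_bounded_eventually
    ((summable_one_div_norm_lattice_pow_three τ).mul_left (2 * ‖z‖ ^ 2)) ?_
  filter_upwards [eventually_norm_lattice_gt τ (2 * ‖z‖)] with q hq
  generalize (q.1 : ℂ) * τ + q.2 = w at hq
  have h1 := half_norm_le_norm_add hq
  have hz := norm_nonneg z
  have hw : 0 < ‖w‖ := by linarith
  have hw0 := norm_pos_iff.mp hw
  have hzw : 0 < ‖z + w‖ := by linarith
  have hzw0 := norm_pos_iff.mp hzw
  have e : 1 / (z + w) - 1 / w + z / w ^ 2 = z ^ 2 / (w ^ 2 * (z + w)) := by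
    field_simp
    ring
  rw [e, norm_div, norm_mul, norm_pow, norm_pow]
  calc ‖z‖ ^ 2 / (‖w‖ ^ 2 * ‖z + w‖) ≤ ‖z‖ ^ 2 / (‖w‖ ^ 2 * (‖w‖ / 2)) := by gcongr
    _ = 2 * ‖z‖ ^ 2 * (1 / ‖w‖ ^ 3) := by field_simp

/-- The involution `(m, n) ↦ (-n, -m)` of `ℤ × ℤ`. -/
def negSwap : ℤ × ℤ ≃ ℤ × ℤ := (Equiv.prodComm ℤ ℤ).trans (Equiv.neg _)

lemma hasSum_wp (τ : ℍ) (z : ℂ) : HasSum (fun q : ℤ × ℤ =>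
    1 / (z + (q.1 * τ + q.2)) ^ 2 - 1 / ((q.1 : ℂ) * τ + q.2) ^ 2) (wp τ z) := by
  have hS := summable_wp τ z
  convert! hS.hasSum using 1
  rw [hS.tsum_eq_add_tsum_ite 0, wp]
  congr 1
  · simp
  · rw [← negSwap.tsum_eq]
    refine tsum_congr fun q => ?_
    have h : negSwap q = 0 ↔ q = 0 := by simp [negSwap, Prod.ext_iff, and_comm]
    by_cases hq : q = 0
    · rw [if_pos (h.mpr hq), if_pos hq]
    · simp only [hq, h, if_false]
      have e : (((negSwap q).1 : ℤ) : ℂ) + ((negSwap q).2 : ℤ) * (τ : ℂ) = -(q.1 * τ + q.2) := by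
        simp [negSwap]
      rw [e, sub_neg_eq_add, neg_sq]

lemma hasSum_wzeta (τ : ℍ) (z : ℂ) : HasSum (fun q : ℤ × ℤ =>
    1 / (z + (q.1 * τ + q.2)) - 1 / ((q.1 : ℂ) * τ + q.2) + z / ((q.1 : ℂ) * τ + q.2) ^ 2)
    (wzeta τ z) := by
  have hS := summable_wzeta τ z
  convert! hS.hasSum using 1
  rw [hS.tsum_eq_add_tsum_ite 0, wzeta]
  congr 1
  · simp
  · rw [← negSwap.tsum_eq]
    refine tsum_congr fun q => ?_
    have h : negSwap q = 0 ↔ q = 0 := by simp [negSwap, Prod.ext_iff, and_comm]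
    by_cases hq : q = 0
    · rw [if_pos (h.mpr hq), if_pos hq]
    · simp only [hq, h, if_false]
      have e : (((negSwap q).1 : ℤ) : ℂ) + ((negSwap q).2 : ℤ) * (τ : ℂ) = -(q.1 * τ + q.2) := by
        simp [negSwap]
      rw [e, sub_neg_eq_add, div_neg, neg_sq, ← sub_eq_add_neg]

lemma hasSum_piCot_intCast_mul (τ : ℍ) (n : ℤ) :
    HasSum (fun m : ℤ => 1 / ((n : ℂ) * τ + m) - 1 / (m : ℂ)) (piCot (n * τ)) := by
  by_cases hn : n = 0
  · simp [hn, piCot_zero]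
  · exact hasSum_piCot (intCast_mul_add_ne_zero τ hn)

lemma hasSum_one_div_sq_e2Summand (τ : ℍ) (n : ℤ) :
    HasSum (fun m : ℤ => 1 / ((n : ℂ) * τ + m) ^ 2) (e2Summand n τ) := by
  have h := (e2Summand_summable n τ).hasSum
  simpa [eisSummand, e2Summand, zpow_neg] using h

lemma hasSum_piCscSq_sub (τ : ℍ) {z : ℂ} (hz : ∀ n m : ℤ, z + n * τ + m ≠ 0) :
    HasSum (fun n : ℤ => piCscSq (z + n * τ) - e2Summand n τ) (wp τ z) :=
  (hasSum_wp τ z).prod_fiberwise fun n => by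
    simpa only [add_assoc] using
      (hasSum_piCscSq (hz n)).sub (hasSum_one_div_sq_e2Summand τ n)

lemma hasSum_piCot_sub_add (τ : ℍ) {z : ℂ} (hz : ∀ n m : ℤ, z + n * τ + m ≠ 0) :
    HasSum (fun n : ℤ => piCot (z + n * τ) - piCot (n * τ) + z * e2Summand n τ) (wzeta τ z) :=
  (hasSum_wzeta τ z).prod_fiberwise fun n => by
    simpa only [sub_sub_sub_cancel_right, add_assoc, mul_one_div] using
      ((hasSum_piCot (hz n)).sub (hasSum_piCot_intCast_mul τ n)).add
        ((hasSum_one_div_sq_e2Summand τ n).mul_left z)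

lemma tendsto_sum_e2Summand (τ : ℍ) :
    Tendsto (fun N : ℕ => ∑ n ∈ Finset.Icc (-(N : ℤ)) N, e2Summand n τ) atTop
      (𝓝 (Real.pi ^ 2 / 3 * eisensteinE2 τ)) := by
  have h := SummationFilter.hasSum_symmetricIcc_iff.mp (hasSum_e2Summand_symmetricIcc τ)
  convert! h using 2
  rw [riemannZeta_two, eisensteinE2, tsum_pnat_eq_tsum_succ
    (f := fun n => (ArithmeticFunction.sigma 1 n : ℂ) * exp (2 * Real.pi * I * τ) ^ n)]
  have e : (fun n : ℕ => ((ArithmeticFunction.sigma 1 (n + 1) : ℕ) : ℂ) *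
      exp (2 * Real.pi * I * ((n : ℂ) + 1) * τ)) =
      fun n : ℕ => (ArithmeticFunction.sigma 1 (n + 1) : ℂ) *
        exp (2 * Real.pi * I * τ) ^ (n + 1) := by
    funext n
    rw [← exp_nat_mul]
    congr 2
    push_cast
    ring
  rw [e]
  ring

lemma HasSum.tendsto_sum_Icc_neg {f : ℤ → ℂ} {a : ℂ} (h : HasSum f a) :
    Tendsto (fun N : ℕ => ∑ n ∈ Finset.Icc (-(N : ℤ)) N, f n) atTop (𝓝 a) :=
  h.comp Finset.tendsto_Icc_neg

lemma hasSum_Pfun (τ : ℍ) {z : ℂ} (hz : ∀ n m : ℤ, z + n * τ + m ≠ 0) :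
    HasSum (fun n : ℤ => piCscSq (z + n * τ)) (Pfun τ z) := by
  obtain ⟨u, hu, hb⟩ := exists_summable_bound_piCscSq τ.im_pos
    fun n => sin_pi_mul_ne_zero_of_forall (hz n)
  have hS : Summable fun n : ℤ => piCscSq (z + n * τ) :=
    .of_norm_bounded hu fun n => (hb.self_of_nhds n).2
  have h := (hasSum_piCscSq_sub τ hz).tendsto_sum_Icc_neg.add (tendsto_sum_e2Summand τ)
  simp only [← Finset.sum_add_distrib, sub_add_cancel] at h
  rw [Pfun, ← tendsto_nhds_unique hS.hasSum.tendsto_sum_Icc_neg h]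
  exact hS.hasSum

lemma tendsto_sum_piCot_zetafun (τ : ℍ) {z : ℂ} (hz : ∀ n m : ℤ, z + n * τ + m ≠ 0) :
    Tendsto (fun N : ℕ => ∑ n ∈ Finset.Icc (-(N : ℤ)) N, piCot (z + n * τ)) atTop
      (𝓝 (zetafun τ z)) := by
  have h := (hasSum_piCot_sub_add τ hz).tendsto_sum_Icc_neg.sub
    ((tendsto_sum_e2Summand τ).mul_const z)
  refine h.congr fun N => ?_
  have h0 : ∑ n ∈ Finset.Icc (-(N : ℤ)) N, piCot (n * τ) = 0 :=
    sum_Icc_neg_eq_zero (k := fun n : ℤ => piCot (n * τ)) (fun j => by simp [piCot_neg]) N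
  rw [Finset.sum_add_distrib, Finset.sum_sub_distrib, h0, ← Finset.mul_sum]
  ring

/-- Second-order termwise differentiation of a series of holomorphic functions. -/
lemma hasSum_deriv_deriv_of_summable_norm {ι : Type*} {F : ι → ℂ → ℂ} {U : Set ℂ} {z : ℂ}
    {u : ι → ℝ} (hu : Summable u) (hf : ∀ i, DifferentiableOn ℂ (F i) U) (hU : IsOpen U)
    (hF_le : ∀ i, ∀ w ∈ U, ‖F i w‖ ≤ u i) (hz : z ∈ U) :
    HasSum (fun i => deriv (deriv (F i)) z) (deriv (deriv fun w => ∑' i, F i w) z) := by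
  rw [HasSum]
  have hd (i : ι) : DifferentiableOn ℂ (deriv (F i)) U := (hf i).deriv hU
  have hc := (tendstoUniformlyOn_tsum hu hF_le).tendstoLocallyUniformlyOn
  have hc' := hc.deriv (Eventually.of_forall fun s => .fun_sum fun i _ => hf i) hU
  have hc'' := hc'.deriv
    (Eventually.of_forall fun s => (DifferentiableOn.fun_sum fun i _ => hf i).deriv hU) hU
  refine (hc''.tendsto_at hz).congr fun s => ?_
  have he : (deriv fun w => ∑ i ∈ s, F i w) =ᶠ[𝓝 z] fun w => ∑ i ∈ s, deriv (F i) w := by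
    filter_upwards [hU.mem_nhds hz] with w hw
    exact deriv_fun_sum fun i _ => (hf i).differentiableAt (hU.mem_nhds hw)
  refine he.deriv_eq.trans ?_
  exact deriv_fun_sum fun i _ => (hd i).differentiableAt (hU.mem_nhds hz)

lemma hasDerivAt_piCscSq_deriv {w : ℂ} (hw : sin (Real.pi * w) ≠ 0) :
    HasDerivAt (fun v => -2 * piCot v * piCscSq v)
      (2 * piCscSq w ^ 2 + 4 * piCot w ^ 2 * piCscSq w) w := by
  refine (((hasDerivAt_piCot hw).const_mul (-2)).mul (hasDerivAt_piCscSq hw)).congr_deriv ?_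
  ring

lemma add_mul_add_ne_zero_of_sin {τ z : ℂ} (h : ∀ n : ℤ, sin (Real.pi * (z + n * τ)) ≠ 0)
    (n m : ℤ) : z + n * τ + m ≠ 0 :=
  add_intCast_ne_zero_of_sin (h n) m

lemma exists_isOpen_bound_piCscSq (τ : ℍ) {z : ℂ} (hz : ∀ n m : ℤ, z + n * τ + m ≠ 0) :
    ∃ (U : Set ℂ) (u : ℤ → ℝ), IsOpen U ∧ z ∈ U ∧ Summable u ∧ ∀ w ∈ U, ∀ n : ℤ,
      sin (Real.pi * (w + n * τ)) ≠ 0 ∧ ‖piCscSq (w + n * τ)‖ ≤ u n := by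
  obtain ⟨u, hu, hb⟩ := exists_summable_bound_piCscSq τ.im_pos
    fun n => sin_pi_mul_ne_zero_of_forall (hz n)
  have hb' : ∀ᶠ w in 𝓝 z, ∀ n : ℤ,
      sin (Real.pi * (w + n * τ)) ≠ 0 ∧ ‖piCscSq (w + n * τ)‖ ≤ u n :=
    (show ContinuousAt (fun w : ℂ => (w, (τ : ℂ))) z by fun_prop).eventually hb
  obtain ⟨U, hU, hUo, hzU⟩ := eventually_nhds_iff.mp hb'
  exact ⟨U, u, hUo, hzU, hu, hU⟩

lemma hasDerivAt_piCscSq_add (a : ℂ) {w : ℂ} (hw : sin (Real.pi * (w + a)) ≠ 0) :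
    HasDerivAt (fun v => piCscSq (v + a)) (-2 * piCot (w + a) * piCscSq (w + a)) w :=
  (hasDerivAt_piCscSq hw).comp_add_const w a

lemma hasSum_deriv_Pfun (τ : ℍ) {z : ℂ} (hz : ∀ n m : ℤ, z + n * τ + m ≠ 0) :
    HasSum (fun n : ℤ => -2 * piCot (z + n * τ) * piCscSq (z + n * τ)) (deriv (Pfun τ) z) ∧
    HasSum (fun n : ℤ => 2 * piCscSq (z + n * τ) ^ 2
      + 4 * piCot (z + n * τ) ^ 2 * piCscSq (z + n * τ)) (deriv (deriv (Pfun τ)) z) := by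
  obtain ⟨U, u, hUo, hzU, hu, hU⟩ := exists_isOpen_bound_piCscSq τ hz
  have hd (n : ℤ) {w : ℂ} (hw : w ∈ U) := hasDerivAt_piCscSq_add (n * τ) (hU w hw n).1
  have hdiff (n : ℤ) : DifferentiableOn ℂ (fun w => piCscSq (w + n * τ)) U := fun w hw =>
    (hd n hw).differentiableAt.differentiableWithinAt
  have he : (fun w => ∑' n : ℤ, piCscSq (w + n * τ)) =ᶠ[𝓝 z] Pfun τ := by
    filter_upwards [hUo.mem_nhds hzU] with w hw
    exact (hasSum_Pfun τ (add_mul_add_ne_zero_of_sin fun n => (hU w hw n).1)).tsum_eq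
  have h1 := hasSum_deriv_of_summable_norm hu hdiff hUo (fun n w hw => (hU w hw n).2) hzU
  have h2 := hasSum_deriv_deriv_of_summable_norm hu hdiff hUo (fun n w hw => (hU w hw n).2) hzU
  rw [he.deriv_eq] at h1
  rw [he.deriv.deriv_eq] at h2
  refine ⟨?_, ?_⟩
  · simpa only [(hd _ hzU).deriv] using h1
  · convert! h2 using 1
    funext n
    have e : deriv (fun w => piCscSq (w + n * τ)) =ᶠ[𝓝 z]
        fun w => -2 * piCot (w + n * τ) * piCscSq (w + n * τ) := by
      filter_upwards [hUo.mem_nhds hzU] with w hw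
      exact (hd n hw).deriv
    rw [e.deriv_eq]
    exact ((hasDerivAt_piCscSq_deriv (hU z hzU n).1).comp_add_const z (n * τ)).deriv.symm

lemma hasSum_deriv_Pfun_left (τ : ℍ) {z : ℂ} (hz : ∀ n m : ℤ, z + n * τ + m ≠ 0) :
    HasSum (fun n : ℤ => n * (-2 * piCot (z + n * τ) * piCscSq (z + n * τ)))
      (deriv (fun s => Pfun s z) τ) := by
  obtain ⟨u, hu, hb⟩ := exists_summable_bound_piCscSq τ.im_pos
    fun n => sin_pi_mul_ne_zero_of_forall (hz n)
  have hb' : ∀ᶠ s in 𝓝 (τ : ℂ), ∀ n : ℤ,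
      sin (Real.pi * (z + n * s)) ≠ 0 ∧ ‖piCscSq (z + n * s)‖ ≤ u n :=
    (show ContinuousAt (fun s : ℂ => (z, s)) τ by fun_prop).eventually hb
  have him : ∀ᶠ s : ℂ in 𝓝 τ, 0 < s.im := continuous_im.continuousAt.eventually_const_lt τ.im_pos
  obtain ⟨U, hU, hUo, hτU⟩ := eventually_nhds_iff.mp (hb'.and him)
  have hd (n : ℤ) {s : ℂ} (hs : s ∈ U) : HasDerivAt (fun s : ℂ => piCscSq (z + n * s))
      (n * (-2 * piCot (z + n * s) * piCscSq (z + n * s))) s := by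
    have h : HasDerivAt (fun s : ℂ => z + n * s) (n : ℂ) s := by
      simpa using ((hasDerivAt_id s).const_mul (n : ℂ)).const_add z
    exact ((hasDerivAt_piCscSq ((hU s hs).1 n).1).comp s h).congr_deriv (mul_comm _ _)
  have he : (fun s : ℂ => ∑' n : ℤ, piCscSq (z + n * s)) =ᶠ[𝓝 (τ : ℂ)] fun s => Pfun s z := by
    filter_upwards [hUo.mem_nhds hτU] with s hs
    exact (hasSum_Pfun ⟨s, (hU s hs).2⟩
      (add_mul_add_ne_zero_of_sin fun n => ((hU s hs).1 n).1)).tsum_eq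
  have h := hasSum_deriv_of_summable_norm hu
    (fun n s hs => (hd n hs).differentiableAt.differentiableWithinAt) hUo
    (fun n s hs => ((hU s hs).1 n).2) hτU
  rw [he.deriv_eq] at h
  simpa only [(hd _ hτU).deriv] using h

lemma tendsto_sum_mul_sum_piCot (τ : ℍ) {z : ℂ} (hz : ∀ n m : ℤ, z + n * τ + m ≠ 0) :
    Tendsto (fun N : ℕ => ∑ n ∈ Finset.Icc (-(N : ℤ)) N,
        -2 * piCot (z + n * τ) * piCscSq (z + n * τ) *
          ∑ m ∈ Finset.Icc (-(N : ℤ)) N, piCot ((m - n : ℤ) * τ)) atTop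
      (𝓝 (2 * Real.pi * I * deriv (fun s => Pfun s z) τ)) := by
  set s' : ℤ → ℂ := fun n => -2 * piCot (z + n * τ) * piCscSq (z + n * τ)
  set k : ℤ → ℂ := fun j => piCot (j * τ)
  have hk (j : ℤ) : k (-j) = -k j := by simp [k, piCot_neg]
  obtain ⟨C, hC⟩ := exists_norm_piCot_intCast_mul_le τ.im_pos
  have hs := hasSum_deriv_Pfun_left τ hz
  have h := tendsto_tsum_of_dominated_convergence (𝓕 := atTop)
    (f := fun (N : ℕ) (n : ℤ) => (Finset.Icc (-(N : ℤ)) N : Set ℤ).indicator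
      (fun n => s' n * ∑ m ∈ Finset.Icc (-(N : ℤ)) N, k (m - n)) n)
    (g := fun n => 2 * Real.pi * I * (n * s' n))
    (bound := fun n => 2 * C * ‖n * s' n‖) (hs.summable.norm.mul_left (2 * C)) (fun n => ?_)
    (Eventually.of_forall fun N n => ?_)
  · rw [tsum_mul_left, hs.tsum_eq] at h
    refine h.congr fun N => ?_
    rw [← sum_eq_tsum_indicator]
  · have h1 := (tendsto_sum_Icc_sub hk (tendsto_piCot_mul_atTop τ.im_pos) n).const_mul (s' n)
    have h2 : s' n * (-2 * -(Real.pi * I) * n) = 2 * Real.pi * I * (n * s' n) := by ring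
    rw [h2] at h1
    refine h1.congr' ?_
    filter_upwards [eventually_ge_atTop n.natAbs] with N hN
    rw [Set.indicator_of_mem]
    simp
    omega
  · refine (norm_indicator_le_norm_self _ _).trans ?_
    rw [norm_mul (s' n), norm_mul (n : ℂ), norm_intCast]
    have := norm_sum_Icc_sub_le hk hC N n
    calc _ ≤ ‖s' n‖ * (2 * C * |(n : ℝ)|) := by gcongr
      _ = _ := by ring

/-- Heat-type equation for the modified Weierstrass function:
`2πi ∂_τ P(z;τ) = ζ(z;τ) P′(z;τ) − P(z;τ)² + (1/2) P″(z;τ)`. -/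
theorem modified_P_heat_equation
    (τ : ℂ) (hτ : 0 < τ.im) (z : ℂ) (hz : z ∉ latticeSet τ) :
    2 * (Real.pi : ℂ) * Complex.I * deriv (fun s => Pfun s z) τ =
      zetafun τ z * deriv (Pfun τ) z - (Pfun τ z) ^ 2
        + (1 / 2) * deriv (deriv (Pfun τ)) z := by
  lift τ to ℍ using hτ
  replace hz (n m : ℤ) : z + n * τ + m ≠ 0 := fun h =>
    hz ⟨-m, -n, by push_cast; linear_combination h⟩
  have hsin (n : ℤ) := sin_pi_mul_ne_zero_of_forall (hz n)
  have hs (n : ℤ) := piCscSq_eq (hsin n)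
  have hP := (hasSum_Pfun τ hz).tendsto_sum_Icc_neg
  have hP' := (hasSum_deriv_Pfun τ hz).1.tendsto_sum_Icc_neg
  have hP'' := (hasSum_deriv_Pfun τ hz).2.tendsto_sum_Icc_neg
  have hleft := (((tendsto_sum_piCot_zetafun τ hz).mul hP').sub (hP.pow 2)).add
    (hP''.const_mul (1 / 2))
  refine tendsto_nhds_unique (tendsto_sum_mul_sum_piCot τ hz) (hleft.congr fun N => ?_)
  simp only [hs]
  refine sum_mul_sum_sub_sq_add_half_sum _ (fun n => piCot (z + n * τ)) (fun j => piCot (j * τ))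
    (by simp [piCot_zero]) (fun j => by simp [piCot_neg]) fun m n hmn => ?_
  have e : ((m - n : ℤ) : ℂ) * τ = (z + m * τ) - (z + n * τ) := by push_cast; ring
  rw [e]
  refine piCot_sub_mul (hsin n) (hsin m) (sin_pi_mul_ne_zero_of_forall fun l => ?_)
  rw [← e]
  exact intCast_mul_add_ne_zero τ (sub_ne_zero.mpr hmn) l
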